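/- Work in the single-node H∞ filtering setting. Suppose Y : [0,∞) → ℝ^{n×n} is differentiable at a time t ≥ 0, Y(t) is symmetric positive definite, and Y satisfies the filtering Riccati differential equation at t: Y'(t) = A(t)Y(t) + Y(t)A(t)ᵀ + B(t)B(t)ᵀ − Y(t)(C(t)ᵀ(D(t)D(t)ᵀ)⁻¹C(t) + Σ_{j∈J} W_jᵀU_j⁻¹W_j − γ⁻²R)Y(t). Suppose e : [0,∞) → ℝⁿ is differentiable at t and satisfies e'(t) = (A(t) − L(t)C(t) − Σ_{j∈J} K_j(t)W_j)e(t) + Σ_{j∈J} K_j(t)W_j ε_j + B(t)w − L(t)D(t)v − Σ_{j∈J} K_j(t)H_j v_j, where ε_j ∈ ℝⁿ, w ∈ ℝ^q, v ∈ ℝ^r, v_j ∈ ℝ^{h_j} are arbitrary fixed vectors and L(t) = Y(t)C(t)ᵀ(D(t)D(t)ᵀ)⁻¹, K_j(t) = Y(t)W_jᵀU_j⁻¹. Then the storage function V(s) := γ²·e(s)ᵀY(s)⁻¹e(s) is differentiable at t and satisfies the dissipation inequality V'(t) ≤ γ²(‖w‖² + ‖v‖² + Σ_{j∈J}(‖v_j‖²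 + ‖W_jε_j‖²_{Z_j⁻¹})) − e(t)ᵀR e(t). -/

import Mathlib

open Matrix Finset

section InverseDerivative

attribute [local instance] Matrix.linftyOpNormedRing Matrix.linftyOpNormedAlgebra

/-- The derivative of the inverse of a matrix-valued curve, entrywise. -/
theorem hasDerivAt_matrix_inv_apply {m : Type*} [Fintype m] [DecidableEq m]
    {Y : ℝ → Matrix m m ℝ} {Y' : Matrix m m ℝ} {t : ℝ} (hY : IsUnit (Y t))
    (h : ∀ a b, HasDerivAt (fun s => Y s a b) (Y' a b) t) (a b : m) :
    HasDerivAt (fun s => (Y s)⁻¹ a b) ((-((Y t)⁻¹ * Y' * (Y t)⁻¹)) a b) t := by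
  have hYd : HasDerivAt Y Y' t :=
    hasDerivAt_pi.2 fun a => hasDerivAt_pi.2 fun b => h a b
  obtain ⟨u, hu⟩ := hY
  have hinv : HasFDerivAt Ring.inverse _ (Y t) := hu ▸ hasFDerivAt_ringInverse (𝕜 := ℝ) u
  have hcomp := hinv.comp_hasDerivAt t hYd
  have hfun : Ring.inverse ∘ Y = fun s => (Y s)⁻¹ :=
    funext fun s => (Matrix.nonsing_inv_eq_ringInverse _).symm
  have hder : (-ContinuousLinearMap.mulLeftRight ℝ (Matrix m m ℝ) ↑u⁻¹ ↑u⁻¹) Y'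
      = -((Y t)⁻¹ * Y' * (Y t)⁻¹) := by
    rw [← hu, ← Matrix.coe_units_inv]
    rfl
  rw [hfun, hder] at hcomp
  exact hasDerivAt_pi.1 (hasDerivAt_pi.1 hcomp a) b

end InverseDerivative

/-- The derivative of the quadratic form `e(s)ᵀ Y(s)⁻¹ e(s)` when `Y t` is symmetric. -/
theorem hasDerivAt_dotProduct_inv_mulVec {m : Type*} [Fintype m] [DecidableEq m]
    {Y : ℝ → Matrix m m ℝ} {Y' : Matrix m m ℝ} {e : ℝ → m → ℝ} {e' x : m → ℝ} {t : ℝ}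
    (hY : IsUnit (Y t)) (hsymm : (Y t)ᵀ = Y t)
    (h : ∀ a b, HasDerivAt (fun s => Y s a b) (Y' a b) t) (he : HasDerivAt e e' t)
    (hx : Y t *ᵥ x = e t) :
    HasDerivAt (fun s => e s ⬝ᵥ ((Y s)⁻¹ *ᵥ e s)) (2 * (x ⬝ᵥ e') - x ⬝ᵥ (Y' *ᵥ x)) t := by
  have hdet : IsUnit (Y t).det := (Matrix.isUnit_iff_isUnit_det _).1 hY
  have hx' : (Y t)⁻¹ *ᵥ e t = x := by
    rw [← hx, mulVec_mulVec, nonsing_inv_mul _ hdet, one_mulVec]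
  have hx'' : e t ᵥ* (Y t)⁻¹ = x := by
    rw [← hx', ← mulVec_transpose, transpose_nonsing_inv, hsymm]
  have hei := hasDerivAt_pi.1 he
  have hd : HasDerivAt (fun s => e s ⬝ᵥ ((Y s)⁻¹ *ᵥ e s))
      (e' ⬝ᵥ ((Y t)⁻¹ *ᵥ e t)
        + e t ⬝ᵥ ((-((Y t)⁻¹ * Y' * (Y t)⁻¹)) *ᵥ e t + (Y t)⁻¹ *ᵥ e')) t := by
    simp only [dotProduct, mulVec, Pi.add_apply, ← Finset.sum_add_distrib]
    exact HasDerivAt.fun_sum fun i _ => (hei i).fun_mul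
      (HasDerivAt.fun_sum fun k _ => (hasDerivAt_matrix_inv_apply hY h i k).fun_mul (hei k))
  convert hd using 1
  rw [hx', dotProduct_add, neg_mulVec, dotProduct_neg, ← mulVec_mulVec, ← mulVec_mulVec, hx',
    dotProduct_mulVec (e t), dotProduct_mulVec (e t), hx'', dotProduct_comm e' x]
  ring

/-- Completing the square. -/
theorem two_mul_dotProduct_sub_le {m : Type*} [Fintype m] (a b : m → ℝ) :
    2 * (a ⬝ᵥ b) - a ⬝ᵥ a ≤ b ⬝ᵥ b := by
  have h : 0 ≤ (a - b) ⬝ᵥ (a - b) := Finset.sum_nonneg fun i _ => mul_self_nonneg _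
  simp only [sub_dotProduct, dotProduct_sub, dotProduct_comm b a] at h
  linarith

/-- Completing the square with respect to a positive definite weight. -/
theorem Matrix.PosDef.two_mul_dotProduct_sub_le {m : Type*} [Fintype m] [DecidableEq m]
    {Z : Matrix m m ℝ} (hZ : Z.PosDef) (y b : m → ℝ) :
    2 * (y ⬝ᵥ b) - y ⬝ᵥ (Z *ᵥ y) ≤ b ⬝ᵥ (Z⁻¹ *ᵥ b) := by
  have hT : Zᵀ = Z := hZ.isHermitian
  have hb : Z *ᵥ (Z⁻¹ *ᵥ b) = b := by
    rw [mulVec_mulVec, mul_nonsing_inv _ ((Matrix.isUnit_iff_isUnit_det _).1 hZ.isUnit),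
      one_mulVec]
  have h : 0 ≤ (y - Z⁻¹ *ᵥ b) ⬝ᵥ (Z *ᵥ (y - Z⁻¹ *ᵥ b)) :=
    hZ.posSemidef.dotProduct_mulVec_nonneg (y - Z⁻¹ *ᵥ b)
  have hc : (Z⁻¹ *ᵥ b) ⬝ᵥ (Z *ᵥ y) = y ⬝ᵥ b := by
    rw [dotProduct_mulVec, ← mulVec_transpose, hT, hb, dotProduct_comm]
  rw [mulVec_sub, hb, sub_dotProduct, dotProduct_sub, dotProduct_sub, hc,
    dotProduct_comm (Z⁻¹ *ᵥ b) b] at h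
  linarith

/-- The output-injection supply rate for a noise channel `G`. -/
theorem neg_two_mul_dotProduct_mulVec_sub_le {m k : Type*} [Fintype m] [Fintype k]
    (G : Matrix m k ℝ) (y : m → ℝ) (v : k → ℝ) :
    -2 * (y ⬝ᵥ (G *ᵥ v)) - y ⬝ᵥ ((G * Gᵀ) *ᵥ y) ≤ v ⬝ᵥ v := by
  have h := two_mul_dotProduct_sub_le (Gᵀ *ᵥ y) (-v)
  rw [← mulVec_mulVec, dotProduct_mulVec y G, dotProduct_mulVec y G, ← mulVec_transpose]
  simp only [dotProduct_neg, neg_dotProduct, neg_neg] at h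
  linarith

/-- A weighted-injection term `Y Wᵀ N⁻¹ ξ` paired with `x`, where `Y x = e`. -/
theorem dotProduct_gain_mulVec {m k : Type*} [Fintype m] [Fintype k] [DecidableEq k]
    {P : Matrix m m ℝ} {N : Matrix k k ℝ} (hP : Pᵀ = P) (hN : Nᵀ = N) (W : Matrix k m ℝ)
    (x : m → ℝ) (ξ : k → ℝ) :
    x ⬝ᵥ ((P * Wᵀ * N⁻¹) *ᵥ ξ) = (N⁻¹ *ᵥ (W *ᵥ (P *ᵥ x))) ⬝ᵥ ξ := by
  rw [dotProduct_mulVec, ← mulVec_transpose]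
  simp only [transpose_mul, transpose_transpose, transpose_nonsing_inv, hP, hN, mulVec_mulVec,
    Matrix.mul_assoc]

/-- Pointwise dissipation inequality (Lemma 2 / Remark 3): along the single-node
H∞ filtering error dynamics with gains `L = YCᵀ(DDᵀ)⁻¹`, `K_j = YW_jᵀU_j⁻¹`,
where `Y` solves the filtering Riccati equation at `t`, the storage function
`V(s) = γ² e(s)ᵀY(s)⁻¹e(s)` is differentiable at `t` with
`V'(t) ≤ γ²(‖w‖²+‖v‖²+Σ_j(‖v_j‖²+‖W_jε_j‖²_{Z_j⁻¹})) − e(t)ᵀRe(t)`. -/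
theorem single_node_dissipation
    (n q r p : ℕ) (hn : 1 ≤ n)
    (J : Type) [Fintype J] (pj hj : J → ℕ)
    (A : ℝ → Matrix (Fin n) (Fin n) ℝ)
    (B : ℝ → Matrix (Fin n) (Fin q) ℝ)
    (C : ℝ → Matrix (Fin p) (Fin n) ℝ)
    (D : ℝ → Matrix (Fin p) (Fin r) ℝ)
    (γ : ℝ) (hγ : 0 < γ)
    (R : Matrix (Fin n) (Fin n) ℝ) (hR : R.PosDef)
    (W : (j : J) → Matrix (Fin (pj j)) (Fin n) ℝ)
    (H : (j : J) → Matrix (Fin (pj j)) (Fin (hj j)) ℝ)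
    (Z : (j : J) → Matrix (Fin (pj j)) (Fin (pj j)) ℝ)
    (hZ : ∀ j, (Z j).PosDef)
    (U : (j : J) → Matrix (Fin (pj j)) (Fin (pj j)) ℝ)
    (hU : ∀ j, U j = H j * (H j)ᵀ + Z j)
    (t : ℝ) (ht : 0 ≤ t)
    (hD : (D t * (D t)ᵀ).PosDef)
    (Y : ℝ → Matrix (Fin n) (Fin n) ℝ)
    (hYpos : (Y t).PosDef)
    -- the filtering Riccati differential equation at t (entrywise derivatives)
    (hYder : ∀ a b : Fin n,
      HasDerivAt (fun s : ℝ => Y s a b)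
        ((A t * Y t + Y t * (A t)ᵀ + B t * (B t)ᵀ
          - Y t * ((C t)ᵀ * (D t * (D t)ᵀ)⁻¹ * C t
              + (∑ j : J, (W j)ᵀ * (U j)⁻¹ * W j) - (γ ^ 2)⁻¹ • R) * Y t) a b) t)
    -- the injection gains
    (L : ℝ → Matrix (Fin n) (Fin p) ℝ)
    (hL : L t = Y t * (C t)ᵀ * (D t * (D t)ᵀ)⁻¹)
    (K : (j : J) → ℝ → Matrix (Fin n) (Fin (pj j)) ℝ)
    (hK : ∀ j, K j t = Y t * (W j)ᵀ * (U j)⁻¹)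
    -- arbitrary fixed disturbance and neighbor-error vectors
    (w : Fin q → ℝ) (v : Fin r → ℝ)
    (vj : (j : J) → Fin (hj j) → ℝ) (ε : J → Fin n → ℝ)
    -- the error trajectory and its dynamics at t
    (e : ℝ → Fin n → ℝ)
    (he : HasDerivAt e
      ((A t - L t * C t - ∑ j : J, K j t * W j) *ᵥ e t
        + (∑ j : J, (K j t * W j) *ᵥ ε j)
        + B t *ᵥ w - (L t * D t) *ᵥ v
        - ∑ j : J, (K j t * H j) *ᵥ vj j) t) :
    ∃ V' : ℝ,
      HasDerivAt (fun s : ℝ => γ ^ 2 * (e s ⬝ᵥ ((Y s)⁻¹ *ᵥ e s))) V' t ∧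
      V' ≤ γ ^ 2 * (w ⬝ᵥ w + v ⬝ᵥ v
            + ∑ j : J, (vj j ⬝ᵥ vj j
                + (W j *ᵥ ε j) ⬝ᵥ ((Z j)⁻¹ *ᵥ (W j *ᵥ ε j))))
          - e t ⬝ᵥ (R *ᵥ e t) := by
  classical
  have hYT : (Y t)ᵀ = Y t := hYpos.isHermitian
  have hDT : (D t * (D t)ᵀ)ᵀ = D t * (D t)ᵀ := hD.isHermitian
  have hUpos : ∀ j, (U j).PosDef := fun j => by
    rw [hU j]
    exact PosDef.posSemidef_add (posSemidef_self_mul_conjTranspose (H j)) (hZ j)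
  have hUT : ∀ j, (U j)ᵀ = U j := fun j => (hUpos j).isHermitian
  obtain ⟨x, hx⟩ : ∃ x, Y t *ᵥ x = e t := ⟨(Y t)⁻¹ *ᵥ e t, by
    rw [mulVec_mulVec, mul_nonsing_inv _ ((Matrix.isUnit_iff_isUnit_det _).1 hYpos.isUnit),
      one_mulVec]⟩
  refine ⟨_, (hasDerivAt_dotProduct_inv_mulVec hYpos.isUnit hYT hYder he hx).const_mul _, ?_⟩
  set c := (D t * (D t)ᵀ)⁻¹ *ᵥ (C t *ᵥ e t) with hc
  set y : (j : J) → Fin (pj j) → ℝ := fun j => (U j)⁻¹ *ᵥ (W j *ᵥ e t) with hy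
  have hNc : (D t * (D t)ᵀ) *ᵥ c = C t *ᵥ e t := by
    rw [hc, mulVec_mulVec, mul_nonsing_inv _ ((Matrix.isUnit_iff_isUnit_det _).1 hD.isUnit),
      one_mulVec]
  have hUy : ∀ j, U j *ᵥ y j = W j *ᵥ e t := fun j => by
    rw [hy, mulVec_mulVec, mul_nonsing_inv _
      ((Matrix.isUnit_iff_isUnit_det _).1 (hUpos j).isUnit), one_mulVec]
  have hLx : ∀ ξ, x ⬝ᵥ (L t *ᵥ ξ) = c ⬝ᵥ ξ := fun ξ => by
    rw [hL, dotProduct_gain_mulVec hYT hDT, hx]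
  have hKx : ∀ j ξ, x ⬝ᵥ (K j t *ᵥ ξ) = y j ⬝ᵥ ξ := fun j ξ => by
    rw [hK, dotProduct_gain_mulVec hYT (hUT j), hx]
  have hYx : ∀ ξ, x ⬝ᵥ (Y t *ᵥ ξ) = e t ⬝ᵥ ξ := fun ξ => by
    rw [dotProduct_mulVec, ← mulVec_transpose, hYT, hx]
  have he' : x ⬝ᵥ ((A t - L t * C t - ∑ j : J, K j t * W j) *ᵥ e t
        + (∑ j : J, (K j t * W j) *ᵥ ε j)
        + B t *ᵥ w - (L t * D t) *ᵥ v
        - ∑ j : J, (K j t * H j) *ᵥ vj j)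
      = x ⬝ᵥ (A t *ᵥ e t) - c ⬝ᵥ ((D t * (D t)ᵀ) *ᵥ c) - ∑ j, y j ⬝ᵥ (U j *ᵥ y j)
        + ∑ j, y j ⬝ᵥ (W j *ᵥ ε j) + x ⬝ᵥ (B t *ᵥ w) - c ⬝ᵥ (D t *ᵥ v)
        - ∑ j, y j ⬝ᵥ (H j *ᵥ vj j) := by
    simp only [dotProduct_sub, dotProduct_add, sub_mulVec, sum_mulVec, dotProduct_sum,
      ← mulVec_mulVec, hLx, hKx, hUy, hNc]
  have hcq : e t ⬝ᵥ (((C t)ᵀ * (D t * (D t)ᵀ)⁻¹ * C t) *ᵥ e t)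
      = c ⬝ᵥ ((D t * (D t)ᵀ) *ᵥ c) := by
    rw [hNc, ← mulVec_mulVec, ← mulVec_mulVec, ← hc, dotProduct_mulVec, vecMul_transpose,
      dotProduct_comm]
  have hyq : ∀ j, e t ⬝ᵥ (((W j)ᵀ * (U j)⁻¹ * W j) *ᵥ e t) = y j ⬝ᵥ (U j *ᵥ y j) := fun j => by
    rw [hUy, ← mulVec_mulVec, ← mulVec_mulVec, dotProduct_mulVec, vecMul_transpose,
      dotProduct_comm]
  have hAT : x ⬝ᵥ (Y t *ᵥ ((A t)ᵀ *ᵥ x)) = x ⬝ᵥ (A t *ᵥ e t) := by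
    rw [hYx, dotProduct_mulVec, vecMul_transpose, dotProduct_comm]
  have hY' : x ⬝ᵥ ((A t * Y t + Y t * (A t)ᵀ + B t * (B t)ᵀ
          - Y t * ((C t)ᵀ * (D t * (D t)ᵀ)⁻¹ * C t
              + (∑ j : J, (W j)ᵀ * (U j)⁻¹ * W j) - (γ ^ 2)⁻¹ • R) * Y t) *ᵥ x)
      = 2 * (x ⬝ᵥ (A t *ᵥ e t)) + x ⬝ᵥ ((B t * (B t)ᵀ) *ᵥ x)
        - (c ⬝ᵥ ((D t * (D t)ᵀ) *ᵥ c) + ∑ j, y j ⬝ᵥ (U j *ᵥ y j)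
          - (γ ^ 2)⁻¹ * (e t ⬝ᵥ (R *ᵥ e t))) := by
    rw [sub_mulVec, add_mulVec, add_mulVec, dotProduct_sub, dotProduct_add, dotProduct_add,
      ← mulVec_mulVec x (A t), ← mulVec_mulVec x (Y t), hx, hAT,
      ← mulVec_mulVec x _ (Y t), ← mulVec_mulVec _ (Y t), hx, hYx, sub_mulVec, add_mulVec,
      sum_mulVec, smul_mulVec, dotProduct_sub, dotProduct_add, dotProduct_sum, dotProduct_smul,
      hcq, Finset.sum_congr rfl fun j _ => hyq j, smul_eq_mul]
    ring
  have hw : 2 * (x ⬝ᵥ (B t *ᵥ w)) - x ⬝ᵥ ((B t * (B t)ᵀ) *ᵥ x) ≤ w ⬝ᵥ w := by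
    simpa [mulVec_neg] using neg_two_mul_dotProduct_mulVec_sub_le (B t) x (-w)
  have hv := neg_two_mul_dotProduct_mulVec_sub_le (D t) c v
  have hj : 2 * ∑ j, y j ⬝ᵥ (W j *ᵥ ε j) - 2 * ∑ j, y j ⬝ᵥ (H j *ᵥ vj j)
      - ∑ j, y j ⬝ᵥ (U j *ᵥ y j)
      ≤ ∑ j, (vj j ⬝ᵥ vj j + (W j *ᵥ ε j) ⬝ᵥ ((Z j)⁻¹ *ᵥ (W j *ᵥ ε j))) := by
    rw [Finset.mul_sum, Finset.mul_sum, ← Finset.sum_sub_distrib, ← Finset.sum_sub_distrib]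
    refine Finset.sum_le_sum fun j _ => ?_
    have h₁ := neg_two_mul_dotProduct_mulVec_sub_le (H j) (y j) (vj j)
    have h₂ := (hZ j).two_mul_dotProduct_sub_le (y j) (W j *ᵥ ε j)
    rw [hU j, add_mulVec, dotProduct_add]
    linarith
  have hγR : γ ^ 2 * ((γ ^ 2)⁻¹ * (e t ⬝ᵥ (R *ᵥ e t))) = e t ⬝ᵥ (R *ᵥ e t) :=
    mul_inv_cancel_left₀ (pow_pos hγ 2).ne' _
  rw [he', hY']
  nth_rewrite 2 [← hγR]
  rw [← mul_sub]
  refine mul_le_mul_of_nonneg_left ?_ (sq_nonneg γ)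
  linarith
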